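/- Let A, B ∈ ℂ^{n₁×n₁×n₃} with A ⋆ B = B ⋆ A = O (the zero tensor), let k = max{ind(A), ind(B)}, and let A^{GD} and B^{GD} be GD inverses of A and B satisfying the GD equations with exponent k. If A^{GD} ⋆ B = B ⋆ A^{GD} = O and B^{GD} ⋆ A = A ⋆ B^{GD} = O, then A^{GD} + B^{GD} is a GD inverse of A + B with exponent k; that is, (A+B) ⋆ (A^{GD}+B^{GD}) ⋆ (A+B) = A+B, (A^{GD}+B^{GD}) ⋆ (A+B)^{k+1} = (A+B)^k, and (A+B)^{k+1} ⋆ (A^{GD}+B^{GD}) = (A+B)^k. -/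

import Mathlib

open Matrix BigOperators

/-- A third-order complex tensor in `ℂ^{n₁ × n₂ × n₃}`, given by its frontal slices. -/
abbrev Tensor3 (n₁ n₂ n₃ : ℕ) := Fin n₃ → Matrix (Fin n₁) (Fin n₂) ℂ

/-- Mode-3 product of a tensor with an `n₃ × n₃` matrix: the slices of the result are the
indicated linear combinations of the slices of `A`. -/
noncomputable def mode3 {n₁ n₂ n₃ : ℕ} (M : Matrix (Fin n₃) (Fin n₃) ℂ) (A : Tensor3 n₁ n₂ n₃) :
    Tensor3 n₁ n₂ n₃ :=
  fun i => ∑ j, M i j • A j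

/-- The M-product `A ⋆_M B`: slice-wise matrix product in the transformed (hat) domain,
transformed back by `M⁻¹`. -/
noncomputable def mprod {n₁ n₂ l n₃ : ℕ} (M : Matrix (Fin n₃) (Fin n₃) ℂ)
    (A : Tensor3 n₁ n₂ n₃) (B : Tensor3 n₂ l n₃) : Tensor3 n₁ l n₃ :=
  mode3 M⁻¹ (fun i => mode3 M A i * mode3 M B i)

/-- The identity tensor: every slice of its mode-3 transform is the identity matrix. -/
noncomputable def idT (n₁ : ℕ) {n₃ : ℕ} (M : Matrix (Fin n₃) (Fin n₃) ℂ) : Tensor3 n₁ n₁ n₃ :=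
  mode3 M⁻¹ (fun _ => (1 : Matrix (Fin n₁) (Fin n₁) ℂ))

/-- Powers of a square tensor with respect to the M-product. -/
noncomputable def mpow {n₁ n₃ : ℕ} (M : Matrix (Fin n₃) (Fin n₃) ℂ) (A : Tensor3 n₁ n₁ n₃) :
    ℕ → Tensor3 n₁ n₁ n₃
  | 0 => idT n₁ M
  | k + 1 => mprod M (mpow M A k) A

/-- Conjugate transpose with respect to the M-product: slice-wise conjugate transpose in the
transformed domain. -/
noncomputable def ctrans {n₁ n₂ n₃ : ℕ} (M : Matrix (Fin n₃) (Fin n₃) ℂ) (A : Tensor3 n₁ n₂ n₃) :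
    Tensor3 n₂ n₁ n₃ :=
  mode3 M⁻¹ (fun i => (mode3 M A i)ᴴ)

/-- Index of a square complex matrix: the least `k ≥ 0` with `rank(B^k) = rank(B^{k+1})`. -/
noncomputable def matIndex {n : ℕ} (B : Matrix (Fin n) (Fin n) ℂ) : ℕ :=
  sInf {k : ℕ | (B ^ k).rank = (B ^ (k + 1)).rank}

/-- Index of a tensor: the maximum of the indices of the slices of its mode-3 transform. -/
noncomputable def tIndex {n₁ n₃ : ℕ} (M : Matrix (Fin n₃) (Fin n₃) ℂ)
    (A : Tensor3 n₁ n₁ n₃) : ℕ :=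
  Finset.univ.sup fun i => matIndex (mode3 M A i)

/-- `X` is a GD inverse of `A` with exponent `k`:
`A ⋆ X ⋆ A = A`, `X ⋆ A^{k+1} = A^k`, `A^{k+1} ⋆ X = A^k`. -/
def IsGD {n₁ n₃ : ℕ} (M : Matrix (Fin n₃) (Fin n₃) ℂ) (A X : Tensor3 n₁ n₁ n₃)
    (k : ℕ) : Prop :=
  mprod M (mprod M A X) A = A ∧
  mprod M X (mpow M A (k + 1)) = mpow M A k ∧
  mprod M (mpow M A (k + 1)) X = mpow M A k

/-- `X` is the Drazin inverse of `A` with exponent `k`. -/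
def IsDrazin {n₁ n₃ : ℕ} (M : Matrix (Fin n₃) (Fin n₃) ℂ) (A X : Tensor3 n₁ n₁ n₃)
    (k : ℕ) : Prop :=
  mprod M X (mpow M A (k + 1)) = mpow M A k ∧
  mprod M (mprod M X A) X = X ∧
  mprod M X A = mprod M A X

/-- `X` is the Moore–Penrose inverse of `A`. -/
def IsMP {n₁ n₃ : ℕ} (M : Matrix (Fin n₃) (Fin n₃) ℂ) (A X : Tensor3 n₁ n₁ n₃) : Prop :=
  mprod M (mprod M A X) A = A ∧
  mprod M (mprod M X A) X = X ∧
  ctrans M (mprod M A X) = mprod M A X ∧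
  ctrans M (mprod M X A) = mprod M X A

theorem mode3_mode3 {n₁ n₂ n₃ : ℕ} (M N : Matrix (Fin n₃) (Fin n₃) ℂ) (A : Tensor3 n₁ n₂ n₃) :
    mode3 M (mode3 N A) = mode3 (M * N) A := by
  funext i
  simp only [mode3, Finset.smul_sum, smul_smul, Matrix.mul_apply, Finset.sum_smul]
  exact Finset.sum_comm

theorem mode3_one {n₁ n₂ n₃ : ℕ} (A : Tensor3 n₁ n₂ n₃) :
    mode3 (1 : Matrix (Fin n₃) (Fin n₃) ℂ) A = A := by
  funext i
  simp [mode3, Matrix.one_apply]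

theorem mode3_zero {n₁ n₂ n₃ : ℕ} (M : Matrix (Fin n₃) (Fin n₃) ℂ) :
    mode3 M (0 : Tensor3 n₁ n₂ n₃) = 0 := by
  funext i
  simp [mode3]

theorem mode3_add {n₁ n₂ n₃ : ℕ} (M : Matrix (Fin n₃) (Fin n₃) ℂ) (A B : Tensor3 n₁ n₂ n₃) :
    mode3 M (A + B) = mode3 M A + mode3 M B := by
  funext i
  simp [mode3, Finset.sum_add_distrib]

theorem mode3_mode3_inv {n₁ n₂ n₃ : ℕ} {M : Matrix (Fin n₃) (Fin n₃) ℂ} (hM : IsUnit M)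
    (A : Tensor3 n₁ n₂ n₃) : mode3 M (mode3 M⁻¹ A) = A := by
  rw [mode3_mode3, Matrix.mul_nonsing_inv _ ((Matrix.isUnit_iff_isUnit_det _).1 hM), mode3_one]

theorem mode3_injective {n₁ n₂ n₃ : ℕ} {M : Matrix (Fin n₃) (Fin n₃) ℂ} (hM : IsUnit M) :
    Function.Injective (mode3 M : Tensor3 n₁ n₂ n₃ → Tensor3 n₁ n₂ n₃) := by
  refine Function.LeftInverse.injective (g := mode3 M⁻¹) fun A => ?_
  rw [mode3_mode3, Matrix.nonsing_inv_mul _ ((Matrix.isUnit_iff_isUnit_det _).1 hM), mode3_one]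

theorem mode3_mprod {n₁ n₃ : ℕ} {M : Matrix (Fin n₃) (Fin n₃) ℂ} (hM : IsUnit M)
    (A B : Tensor3 n₁ n₁ n₃) : mode3 M (mprod M A B) = mode3 M A * mode3 M B :=
  mode3_mode3_inv hM _

theorem mode3_mpow {n₁ n₃ : ℕ} {M : Matrix (Fin n₃) (Fin n₃) ℂ} (hM : IsUnit M)
    (A : Tensor3 n₁ n₁ n₃) (k : ℕ) : mode3 M (mpow M A k) = mode3 M A ^ k := by
  induction k with
  | zero => exact mode3_mode3_inv hM _
  | succ k ih => rw [mpow, mode3_mprod hM, ih, pow_succ]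

theorem isGD_iff {n₁ n₃ : ℕ} {M : Matrix (Fin n₃) (Fin n₃) ℂ} (hM : IsUnit M)
    (A X : Tensor3 n₁ n₁ n₃) (k : ℕ) :
    IsGD M A X k ↔ mode3 M A * mode3 M X * mode3 M A = mode3 M A ∧
      mode3 M X * mode3 M A ^ (k + 1) = mode3 M A ^ k ∧
      mode3 M A ^ (k + 1) * mode3 M X = mode3 M A ^ k := by
  rw [IsGD, ← (mode3_injective hM).eq_iff (b := A), ← (mode3_injective hM).eq_iff (b := mpow M A k),
    ← (mode3_injective hM).eq_iff (b := mpow M A k)]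
  simp only [mode3_mprod hM, mode3_mpow hM]

theorem mprod_eq_zero_iff {n₁ n₃ : ℕ} {M : Matrix (Fin n₃) (Fin n₃) ℂ} (hM : IsUnit M)
    (A B : Tensor3 n₁ n₁ n₃) : mprod M A B = 0 ↔ mode3 M A * mode3 M B = 0 := by
  rw [← (mode3_injective hM).eq_iff, mode3_mprod hM, mode3_zero]

theorem add_pow_succ_of_mul_eq_zero {R : Type*} [Semiring R] {a b : R}
    (hab : a * b = 0) (hba : b * a = 0) (k : ℕ) :
    (a + b) ^ (k + 1) = a ^ (k + 1) + b ^ (k + 1) := by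
  induction k with
  | zero => simp
  | succ k ih =>
    rw [pow_succ, ih, add_mul, mul_add, mul_add, pow_succ a k, pow_succ b k, mul_assoc _ a b,
      mul_assoc _ b a, hab, hba, pow_succ a (k + 1), pow_succ b (k + 1), pow_succ a k,
      pow_succ b k]
    simp

theorem add_gd_of_mul_eq_zero {R : Type*} [Semiring R] {a b x y : R} {k : ℕ}
    (hab : a * b = 0) (hba : b * a = 0)
    (ha : a * x * a = a ∧ x * a ^ (k + 1) = a ^ k ∧ a ^ (k + 1) * x = a ^ k)
    (hb : b * y * b = b ∧ y * b ^ (k + 1) = b ^ k ∧ b ^ (k + 1) * y = b ^ k)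
    (hxb : x * b = 0) (hbx : b * x = 0) (hya : y * a = 0) (hay : a * y = 0) :
    (a + b) * (x + y) * (a + b) = a + b ∧
      (x + y) * (a + b) ^ (k + 1) = (a + b) ^ k ∧
      (a + b) ^ (k + 1) * (x + y) = (a + b) ^ k := by
  obtain ⟨ha₁, ha₂, ha₃⟩ := ha
  obtain ⟨hb₁, hb₂, hb₃⟩ := hb
  cases k with
  | zero =>
    simp only [zero_add, pow_one, pow_zero] at ha₂ hb₂
    have hb0 : b = 0 := by rw [← one_mul b, ← ha₂, mul_assoc, hab, mul_zero]
    have : Subsingleton R := subsingleton_of_zero_eq_one (by rw [← hb₂, hb0, mul_zero])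
    exact ⟨Subsingleton.elim _ _, Subsingleton.elim _ _, Subsingleton.elim _ _⟩
  | succ k =>
    refine ⟨?_, ?_, ?_⟩
    · simp [add_mul, mul_add, hbx, hay, ha₁, hb₁, mul_assoc a x b, mul_assoc b y a, hxb, hya]
    · have h₁ : x * b ^ (k + 1 + 1) = 0 := by rw [pow_succ', ← mul_assoc, hxb, zero_mul]
      have h₂ : y * a ^ (k + 1 + 1) = 0 := by rw [pow_succ', ← mul_assoc, hya, zero_mul]
      simp only [add_pow_succ_of_mul_eq_zero hab hba, add_mul, mul_add, h₁, h₂, ha₂, hb₂,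
        add_zero, zero_add]
    · have h₁ : b ^ (k + 1 + 1) * x = 0 := by rw [pow_succ, mul_assoc, hbx, mul_zero]
      have h₂ : a ^ (k + 1 + 1) * y = 0 := by rw [pow_succ, mul_assoc, hay, mul_zero]
      simp only [add_pow_succ_of_mul_eq_zero hab hba, add_mul, mul_add, h₁, h₂, ha₃, hb₃,
        add_zero, zero_add]

/-- additivity of the GD inverse for tensors with `A ⋆ B = B ⋆ A = O`. -/
theorem gd_additivity {n₁ n₃ : ℕ} (hn₁ : 0 < n₁) (hn₃ : 0 < n₃)
    (M : Matrix (Fin n₃) (Fin n₃) ℂ) (hM : IsUnit M)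
    (A B AGD BGD : Tensor3 n₁ n₁ n₃) (k : ℕ)
    (hAB : mprod M A B = 0) (hBA : mprod M B A = 0)
    (hk : k = max (tIndex M A) (tIndex M B))
    (hAGD : IsGD M A AGD k) (hBGD : IsGD M B BGD k)
    (h1 : mprod M AGD B = 0) (h2 : mprod M B AGD = 0)
    (h3 : mprod M BGD A = 0) (h4 : mprod M A BGD = 0) :
    IsGD M (A + B) (AGD + BGD) k := by
  rw [isGD_iff hM] at hAGD hBGD ⊢
  rw [mprod_eq_zero_iff hM] at hAB hBA h1 h2 h3 h4
  rw [mode3_add, mode3_add]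
  exact add_gd_of_mul_eq_zero hAB hBA hAGD hBGD h1 h2 h3 h4
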